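/- arXiv:2107.00202 — 15 statements merged into one kernel-verified Lean document; each statement's English description precedes it below -/
import Mathlib

section
/- Let d ≥ 4 be an integer. Then the complement in ℕ of the additive submonoid S_a equals the union of {2m : m ∈ ℕ \ H_d} with the set A_d = {2s(d-1)+2t+1 : s,t ∈ ℕ, s ≤ d, t ≤ min(d-2, d-s)} ∪ {2d²-1}. -/
/-- The Weierstrass semigroup `H(P)` of a point of a smooth plane curve of degree `d`
whose tangent line meets the curve with multiplicity `d-1`:
the additive submonoid of `ℕ` generated by `{(d-1) + r(d-2) : 0 ≤ r ≤ d-2}`. -/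
def Hd (d : ℕ) : AddSubmonoid ℕ :=
  AddSubmonoid.closure {x : ℕ | ∃ r : ℕ, r ≤ d - 2 ∧ x = (d - 1) + r * (d - 2)}

/-- The semigroup `2H(P) + (8d-9)ℕ₀ + ⋯ + (8d-9+2(d-3)(d-2))ℕ₀` of Theorem 1.2(a)(ii). -/
def Sa (d : ℕ) : AddSubmonoid ℕ :=
  AddSubmonoid.closure
    ({x : ℕ | ∃ h ∈ Hd d, x = 2 * h} ∪
     {x : ℕ | ∃ r : ℕ, r ≤ d - 3 ∧ x = (8 * d - 9) + 2 * r * (d - 2)})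

/-- The semigroup `2H(P) + (8d-11)ℕ₀ + ⋯ + (8d-11+2(d-4)(d-2))ℕ₀` of Theorem 1.2(b)(i). -/
def Sb (d : ℕ) : AddSubmonoid ℕ :=
  AddSubmonoid.closure
    ({x : ℕ | ∃ h ∈ Hd d, x = 2 * h} ∪
     {x : ℕ | ∃ r : ℕ, r ≤ d - 4 ∧ x = (8 * d - 11) + 2 * r * (d - 2)})

/-- The semigroup `2H(P) + (8d-9)ℕ₀ + ⋯ + (8d-9+2(d-4)(d-2))ℕ₀ + (2d²-1)ℕ₀`
of Theorem 1.2(c). -/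
def Sc (d : ℕ) : AddSubmonoid ℕ :=
  AddSubmonoid.closure
    ({x : ℕ | ∃ h ∈ Hd d, x = 2 * h} ∪
     {x : ℕ | ∃ r : ℕ, r ≤ d - 4 ∧ x = (8 * d - 9) + 2 * r * (d - 2)} ∪
     {2 * d ^ 2 - 1})

/-- The set of odd gaps in case (a):
`{2s(d-1)+2t+1 : s ≤ d, t ≤ min(d-2, d-s)} ∪ {2d²-1}`. -/
def Aset (d : ℕ) : Set ℕ :=
  {x : ℕ | ∃ s t : ℕ, s ≤ d ∧ t ≤ min (d - 2) (d - s) ∧ x = 2 * s * (d - 1) + 2 * t + 1} ∪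
  {2 * d ^ 2 - 1}

/-- The set of odd gaps in case (b)(i):
`{2s(d-1)+2t-1 : s ≤ d, t ≤ min(d-2, d-s), (s,t) ≠ (0,0)} ∪ {2d²-2d+1, 2d²-3}`. -/
def Bset (d : ℕ) : Set ℕ :=
  {x : ℕ | ∃ s t : ℕ, s ≤ d ∧ t ≤ min (d - 2) (d - s) ∧ (s, t) ≠ (0, 0) ∧
    x = 2 * s * (d - 1) + 2 * t - 1} ∪
  {2 * d ^ 2 - 2 * d + 1, 2 * d ^ 2 - 3}

/-- The set of odd gaps in case (c):
`{2s(d-1)+2t+1 : s ≤ d, t ≤ min(d-2, d-s)} ∪ {2d²-2d+3}`. -/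
def Cset (d : ℕ) : Set ℕ :=
  {x : ℕ | ∃ s t : ℕ, s ≤ d ∧ t ≤ min (d - 2) (d - s) ∧ x = 2 * s * (d - 1) + 2 * t + 1} ∪
  {2 * d ^ 2 - 2 * d + 3}

theorem mem_Hd_iff (q n : ℕ) :
    n ∈ Hd (q + 2) ↔ ∃ k j : ℕ, k ≤ j ∧ j ≤ k * (q + 1) ∧ n = k + j * q := by
  have e2 : q + 2 - 2 = q := by omega
  have e1 : q + 2 - 1 = q + 1 := by omega
  constructor
  · intro h
    unfold Hd at h
    rw [e1, e2] at h
    induction h using AddSubmonoid.closure_induction with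
    | mem x hx =>
      obtain ⟨r, hr, rfl⟩ := hx
      exact ⟨1, 1 + r, by omega, by omega, by ring⟩
    | zero => exact ⟨0, 0, by simp, by simp, by simp⟩
    | add x y _ _ hx hy =>
      obtain ⟨k, j, h1, h2, rfl⟩ := hx
      obtain ⟨k', j', h1', h2', rfl⟩ := hy
      exact ⟨k + k', j + j', by omega, by linarith, by ring⟩
  · rintro ⟨k, j, h1, h2, rfl⟩
    induction k generalizing j with
    | zero =>
      have : j = 0 := by simpa using h2
      subst this
      simp
    | succ k ih =>
      have hr : ∃ r j', r ≤ q ∧ j = j' + (1 + r) ∧ k ≤ j' ∧ j' ≤ k * (q + 1) := by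
        have h3 : (k + 1) * (q + 1) = k * (q + 1) + q + 1 := by ring
        have h4 : k ≤ k * (q + 1) := Nat.le_mul_of_pos_right _ (by omega)
        rw [h3] at h2
        by_cases hc : j - 1 - k ≤ q
        · exact ⟨j - 1 - k, k, hc, by omega, le_refl _, h4⟩
        · exact ⟨q, j - 1 - q, le_refl _, by omega, by omega, by omega⟩
      obtain ⟨r, j', hr, rfl, h5, h6⟩ := hr
      have hg : (q + 1) + r * q ∈ Hd (q + 2) := by
        unfold Hd
        rw [e1, e2]
        exact AddSubmonoid.subset_closure ⟨r, hr, rfl⟩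
      have := add_mem (ih j' h5 h6) hg
      convert this using 1
      ring

theorem mem_Sa_iff (q n : ℕ) (hq : 2 ≤ q) :
    n ∈ Sa (q + 2) ↔ (∃ h ∈ Hd (q + 2), n = 2 * h) ∨
      ∃ k J : ℕ, k + 4 ≤ J ∧ J ≤ (k + 1) * (q + 1) + 2 ∧ n = 2 * (k + 3 + J * q) + 1 := by
  have e2 : q + 2 - 2 = q := by omega
  have e1 : 8 * (q + 2) - 9 = 8 * q + 7 := by omega
  have e3 : q + 2 - 3 = q - 1 := by omega
  constructor
  · intro h
    unfold Sa at h
    rw [e1, e2, e3] at h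
    induction h using AddSubmonoid.closure_induction with
    | mem x hx =>
      rcases hx with hx | ⟨r, hr, rfl⟩
      · exact Or.inl hx
      · right
        exact ⟨0, 4 + r, by omega, by omega, by ring⟩
    | zero => exact Or.inl ⟨0, zero_mem _, by simp⟩
    | add x y _ _ hx hy =>
      rcases hx with ⟨h, hh, rfl⟩ | ⟨k, J, h1, h2, rfl⟩ <;>
      rcases hy with ⟨h', hh', rfl⟩ | ⟨k', J', h1', h2', rfl⟩
      · exact Or.inl ⟨h + h', add_mem hh hh', by ring⟩
      · right
        obtain ⟨a, b, ha, hb, rfl⟩ := (mem_Hd_iff _ _).1 hh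
        exact ⟨a + k', b + J', by omega, by linarith, by ring⟩
      · right
        obtain ⟨a, b, ha, hb, rfl⟩ := (mem_Hd_iff _ _).1 hh'
        exact ⟨k + a, J + b, by omega, by linarith, by ring⟩
      · left
        refine ⟨(k + k' + 7) + (J + J') * q, (mem_Hd_iff _ _).2
          ⟨k + k' + 7, J + J', by omega, by nlinarith, rfl⟩, by ring⟩
  · rintro (⟨h, hh, rfl⟩ | ⟨k, J, h1, h2, rfl⟩)
    · exact AddSubmonoid.subset_closure (Or.inl ⟨h, hh, rfl⟩)
    · have hr : ∃ r j, r ≤ q - 1 ∧ J = j + (4 + r) ∧ k ≤ j ∧ j ≤ k * (q + 1) := by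
        have h3 : (k + 1) * (q + 1) = k * (q + 1) + q + 1 := by ring
        have h4 : k ≤ k * (q + 1) := Nat.le_mul_of_pos_right _ (by omega)
        rw [h3] at h2
        by_cases hc : J - 4 - k ≤ q - 1
        · exact ⟨J - 4 - k, k, hc, by omega, le_refl _, h4⟩
        · exact ⟨q - 1, J - 4 - (q - 1), le_refl _, by omega, by omega, by omega⟩
      obtain ⟨r, j, hr, rfl, h5, h6⟩ := hr
      have g1 : 2 * (k + j * q) ∈ Sa (q + 2) :=
        AddSubmonoid.subset_closure (Or.inl ⟨_, (mem_Hd_iff _ _).2 ⟨k, j, h5, h6, rfl⟩, rfl⟩)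
      have g2 : (8 * q + 7) + 2 * r * q ∈ Sa (q + 2) := by
        unfold Sa
        rw [e1, e2, e3]
        exact AddSubmonoid.subset_closure (Or.inr ⟨r, hr, rfl⟩)
      have := add_mem g1 g2
      convert this using 1
      ring

theorem odd_not (q : ℕ) (hq : 2 ≤ q) (N : ℕ)
    (hN : (∃ s t : ℕ, s ≤ q + 2 ∧ t ≤ q ∧ s + t ≤ q + 2 ∧ N = s + t + s * q) ∨
      N = 3 + (q + 4) * q)
    (k J : ℕ) (h1 : k + 4 ≤ J) (h2 : J ≤ (k + 1) * (q + 1) + 2) (h : N = k + 3 + J * q) :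
    False := by
  rcases hN with ⟨s, t, hs, ht, hst, rfl⟩ | rfl
  · rcases Nat.lt_or_ge s J with hJ | hJ
    · have : (s + 1) * q ≤ J * q := Nat.mul_le_mul_right _ hJ
      nlinarith
    · have : J * q ≤ s * q := Nat.mul_le_mul_right _ hJ
      omega
  · rcases Nat.lt_trichotomy J (q + 4) with hJ | hJ | hJ
    · obtain ⟨i, hi⟩ := Nat.exists_eq_add_of_lt hJ
      have : (q + 4) * q = J * q + i * q + q := by rw [hi]; ring
      have : 0 ≤ i * q := Nat.zero_le _
      omega
    · subst hJ
      have : k = 0 := by omega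
      subst this
      omega
    · have : (q + 4 + 1) * q ≤ J * q := Nat.mul_le_mul_right _ hJ
      nlinarith

theorem odd_cover (q : ℕ) (hq : 2 ≤ q) (N : ℕ) :
    ((∃ s t : ℕ, s ≤ q + 2 ∧ t ≤ q ∧ s + t ≤ q + 2 ∧ N = s + t + s * q) ∨
      N = 3 + (q + 4) * q) ∨
    ∃ k J : ℕ, k + 4 ≤ J ∧ J ≤ (k + 1) * (q + 1) + 2 ∧ N = k + 3 + J * q := by
  by_cases hN3 : N < 3
  · exact Or.inl (Or.inl ⟨0, N, by omega, by omega, by omega, by omega⟩)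
  obtain ⟨a, b, ha, hab⟩ : ∃ a b, a < q ∧ N = a + 3 + b * q := by
    refine ⟨(N - 3) % q, (N - 3) / q, Nat.mod_lt _ (by omega), ?_⟩
    have := Nat.mod_add_div (N - 3) q
    rw [mul_comm] at this
    omega
  rcases Nat.lt_or_ge b (a + 4) with hb | hb
  · left; left
    by_cases hc : a + 3 - b ≤ q
    · exact ⟨b, a + 3 - b, by omega, hc, by omega, by omega⟩
    · exact ⟨b + 1, a + 3 - b - (q + 1), by omega, by omega, by omega, by
        have : (b + 1) * q = b * q + q := by ring
        omega⟩
  · obtain ⟨i, c, hc, hbc⟩ : ∃ i c, c ≤ q ∧ b = a + 4 + c + i * (q + 1) := by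
      refine ⟨(b - (a + 4)) / (q + 1), (b - (a + 4)) % (q + 1), ?_, ?_⟩
      · have := Nat.mod_lt (b - (a + 4)) (show q + 1 > 0 by omega)
        omega
      · have := Nat.mod_add_div (b - (a + 4)) (q + 1)
        rw [mul_comm] at this
        omega
    by_cases hex : a + i * q = 0 ∧ c = q
    · obtain ⟨h0, rfl⟩ := hex
      have h01 : a = 0 := by omega
      have h02 : i * c = 0 := by omega
      have h03 : i = 0 := by
        rcases Nat.mul_eq_zero.1 h02 with h | h
        · exact h
        · omega
      subst h01 h03
      left; right
      rw [hab, hbc]; ring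
    · right
      refine ⟨a + i * q, a + 4 + c + i * q, by omega, ?_, by rw [hab, hbc]; ring⟩
      have : a + 4 + c + i * q = a + i * q + 4 + c := by ring
      rcases Nat.eq_zero_or_pos (a + i * q) with h0 | h0
      · rw [this, h0]
        have : c ≠ q := fun h => hex ⟨h0, h⟩
        omega
      · rw [this]
        nlinarith

theorem mem_Aset_iff (q n : ℕ) :
    n ∈ Aset (q + 2) ↔ ∃ N, n = 2 * N + 1 ∧
      ((∃ s t : ℕ, s ≤ q + 2 ∧ t ≤ q ∧ s + t ≤ q + 2 ∧ N = s + t + s * q) ∨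
      N = 3 + (q + 4) * q) := by
  have e2 : q + 2 - 2 = q := by omega
  have e1 : q + 2 - 1 = q + 1 := by omega
  have e3 : 2 * (q + 2) ^ 2 - 1 = 2 * (3 + (q + 4) * q) + 1 := by
    have : 2 * (q + 2) ^ 2 = 2 * (3 + (q + 4) * q) + 1 + 1 := by ring
    omega
  unfold Aset
  rw [e1, e2, e3]
  constructor
  · rintro (⟨s, t, hs, ht, rfl⟩ | h)
    · have := le_min_iff.1 ht
      exact ⟨s + t + s * q, by ring, Or.inl ⟨s, t, hs, this.1, by omega, rfl⟩⟩
    · exact ⟨_, h, Or.inr rfl⟩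
  · rintro ⟨N, rfl, ⟨s, t, hs, ht, hst, rfl⟩ | rfl⟩
    · exact Or.inl ⟨s, t, hs, le_min ht (by omega), by ring⟩
    · exact Or.inr rfl

/-- Theorem 1.2(a)(ii), gap-set description: the complement of `S_a` in `ℕ` is the
union of the even numbers `2m` with `m ∉ H_d` and the set `A_d`. -/
theorem stmt_0 (d : ℕ) (hd : 4 ≤ d) :
    {n : ℕ | n ∉ Sa d} = {n : ℕ | ∃ m : ℕ, m ∉ Hd d ∧ n = 2 * m} ∪ Aset d := by
  obtain ⟨q, rfl⟩ : ∃ q, d = q + 2 := ⟨d - 2, by omega⟩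
  have hq : 2 ≤ q := by omega
  ext n
  rw [Set.mem_union, mem_Aset_iff, Set.mem_setOf_eq, Set.mem_setOf_eq, mem_Sa_iff q n hq]
  constructor
  · intro h
    push Not at h
    obtain ⟨hE, hO⟩ := h
    rcases Nat.even_or_odd' n with ⟨N, rfl | rfl⟩
    · exact Or.inl ⟨N, fun hN => hE N hN rfl, rfl⟩
    · right
      refine ⟨N, rfl, ?_⟩
      rcases odd_cover q hq N with h | ⟨k, J, h1, h2, h3⟩
      · exact h
      · exact absurd (by rw [h3]) (hO k J h1 h2)
  · rintro (⟨m, hm, rfl⟩ | ⟨N, rfl, hN⟩) (⟨h, hh, he⟩ | ⟨k, J, h1, h2, he⟩)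
    · have : m = h := by omega
      exact hm (this ▸ hh)
    · omega
    · omega
    · exact odd_not q hq N hN k J h1 h2 (by omega)
end

section
/- Let d ≥ 4 be an integer. Then the complement in ℕ of the additive submonoid S_b equals the union of {2m : m ∈ ℕ \ H_d} with the set B_d = {2s(d-1)+2t-1 : s,t ∈ ℕ, s ≤ d, t ≤ min(d-2, d-s), (s,t) ≠ (0,0)} ∪ {2d²-2d+1, 2d²-3}. -/
lemma Hd_char (e n : ℕ) : n ∈ Hd (e + 2) ↔
    ∃ k j : ℕ, k ≤ j ∧ j ≤ k * e + k ∧ n = k + j * e := by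
  constructor
  · intro h
    unfold Hd at h
    induction h using AddSubmonoid.closure_induction with
    | mem x hx =>
      obtain ⟨r, hr, rfl⟩ := hx
      have h1 : e + 2 - 2 = e := by omega
      have h2 : e + 2 - 1 = e + 1 := by omega
      rw [h1] at hr
      rw [h1, h2]
      exact ⟨1, 1 + r, by omega, by omega, by ring⟩
    | zero => exact ⟨0, 0, by simp, by simp, by simp⟩
    | add x y _ _ hx hy =>
      obtain ⟨k, j, h1, h2, rfl⟩ := hx
      obtain ⟨k', j', h1', h2', rfl⟩ := hy
      exact ⟨k + k', j + j', by omega, by rw [add_mul]; omega, by ring⟩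
  · rintro ⟨k, j, h1, h2, rfl⟩
    induction k generalizing j with
    | zero =>
      have : j = 0 := by omega
      subst this
      simp
    | succ k ih =>
      rw [add_mul] at h2
      have key : ∃ r j', r ≤ e ∧ k ≤ j' ∧ j' ≤ k * e + k ∧ j = j' + 1 + r := by
        by_cases h : e ≤ j - (k + 1)
        · exact ⟨e, j - 1 - e, by omega, by omega, by omega, by omega⟩
        · exact ⟨j - (k + 1), k, by omega, by omega, by omega, by omega⟩
      obtain ⟨r, j', hr, ha, hb, rfl⟩ := key
      have h3 := ih j' ha hb
      have h4 : (e + 1) + r * e ∈ Hd (e + 2) :=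
        AddSubmonoid.subset_closure ⟨r, by omega, by simp⟩
      have h5 := add_mem h3 h4
      have h6 : k + 1 + (j' + 1 + r) * e = k + j' * e + (e + 1 + r * e) := by ring
      rw [h6]
      exact h5

/-- Half-values of the odd elements. -/
def TT (e y : ℕ) : Prop := ∃ k m : ℕ, k + 4 ≤ m ∧ m ≤ k * e + k + e + 2 ∧ y = k + m * e

lemma Sb_char (e n : ℕ) (he : 2 ≤ e) : n ∈ Sb (e + 2) ↔
    (∃ h ∈ Hd (e + 2), n = 2 * h) ∨ ∃ y, TT e y ∧ n = 5 + 2 * y := by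
  constructor
  · intro h
    unfold Sb at h
    induction h using AddSubmonoid.closure_induction with
    | mem x hx =>
      rcases hx with hx | ⟨r, hr, rfl⟩
      · exact Or.inl hx
      · right
        have h1 : e + 2 - 2 = e := by omega
        have h2 : 8 * (e + 2) - 11 = 8 * e + 5 := by omega
        rw [h1, h2]
        exact ⟨(4 + r) * e, ⟨0, 4 + r, by omega, by omega, by ring⟩, by ring⟩
    | zero => exact Or.inl ⟨0, zero_mem _, rfl⟩
    | add x y _ _ hx hy =>
      rcases hx with ⟨h, hh, rfl⟩ | ⟨y1, ⟨k, m, h1, h2, rfl⟩, rfl⟩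
      · rcases hy with ⟨h', hh', rfl⟩ | ⟨y2, ⟨k', m', h1', h2', rfl⟩, rfl⟩
        · exact Or.inl ⟨h + h', add_mem hh hh', by ring⟩
        · right
          obtain ⟨k, j, a, b, rfl⟩ := (Hd_char e h).1 hh
          exact ⟨_, ⟨k + k', j + m', by omega, by rw [add_mul]; omega, rfl⟩, by ring⟩
      · rcases hy with ⟨h', hh', rfl⟩ | ⟨y2, ⟨k', m', h1', h2', rfl⟩, rfl⟩
        · right
          obtain ⟨k', j, a, b, rfl⟩ := (Hd_char e h').1 hh'
          exact ⟨_, ⟨k + k', m + j, by omega, by rw [add_mul]; omega, rfl⟩, by ring⟩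
        · left
          refine ⟨(k + k' + 5) + (m + m') * e, (Hd_char e _).2
            ⟨k + k' + 5, m + m', by omega, by rw [add_mul, add_mul]; omega, rfl⟩, by ring⟩
  · rintro (h | ⟨y, ⟨k, m, h1, h2, rfl⟩, rfl⟩)
    · exact AddSubmonoid.subset_closure (Or.inl h)
    · have key : ∃ r j, r ≤ e - 2 ∧ k ≤ j ∧ j ≤ k * e + k ∧ m = j + 4 + r := by
        by_cases h : e - 2 ≤ m - 4 - k
        · exact ⟨e - 2, m - 4 - (e - 2), by omega, by omega, by omega, by omega⟩
        · exact ⟨m - 4 - k, k, by omega, by omega, by omega, by omega⟩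
      obtain ⟨r, j, hr, ha, hb, rfl⟩ := key
      have h3 : 2 * (k + j * e) ∈ Sb (e + 2) :=
        AddSubmonoid.subset_closure (Or.inl ⟨_, (Hd_char e _).2 ⟨k, j, ha, hb, rfl⟩, rfl⟩)
      have h4 : (8 * e + 5) + 2 * r * e ∈ Sb (e + 2) :=
        AddSubmonoid.subset_closure (Or.inr ⟨r, by omega, by
          have h1 : e + 2 - 2 = e := by omega
          have h2 : 8 * (e + 2) - 11 = 8 * e + 5 := by omega
          rw [h1, h2]⟩)
      have h5 := add_mem h3 h4
      have h6 : 5 + 2 * (k + (j + 4 + r) * e) = 2 * (k + j * e) + (8 * e + 5 + 2 * r * e) := by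
        ring
      rw [h6]
      exact h5

lemma TT_char (e a b : ℕ) (he : 2 ≤ e) (ha : a < e) : TT e (a + b * e) ↔
    a + 4 ≤ b ∧ ¬ (a = 0 ∧ (b = e + 3 ∨ b = e + 4)) := by
  constructor
  · rintro ⟨k, m, h1, h2, h⟩
    have hk := Nat.mod_add_div k e
    have hk' : k % e < e := Nat.mod_lt _ (by omega)
    generalize k % e = c at *
    generalize k / e = i at *
    subst hk
    have e1 : a = c := by
      have := congrArg (· % e) h
      simpa [Nat.add_mod, Nat.mod_eq_of_lt ha, Nat.mod_eq_of_lt hk'] using this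
    subst e1
    have e2 : b = i + m := by
      have : b * e = (i + m) * e := by linarith
      exact Nat.eq_of_mul_eq_mul_right (by omega) this
    subst e2
    refine ⟨by nlinarith, ?_⟩
    rintro ⟨rfl, h3⟩
    rcases Nat.eq_zero_or_pos i with rfl | hi
    · simp at *; omega
    · have : e ≤ e * i := Nat.le_mul_of_pos_right _ hi
      omega
  · rintro ⟨h1, h2⟩
    by_cases h3 : b ≤ a * e + a + e + 2
    · exact ⟨a, b, h1, h3, rfl⟩
    · -- general shift
      have key : ∀ i : ℕ, a + i * e + i + 4 ≤ b →
          b ≤ (a + i * e) * e + (a + i * e) + e + 2 + i → TT e (a + b * e) := by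
        intro i hi hi'
        obtain ⟨m, rfl⟩ : ∃ m, b = m + i := ⟨b - i, by omega⟩
        exact ⟨a + i * e, m, by omega, by omega, by ring⟩
      have hex : ∃ i : ℕ, b < a + (i + 1) * e + (i + 1) + 4 := ⟨b, by nlinarith⟩
      classical
      have hs := Nat.find_spec hex
      have hm := fun i => @Nat.find_min _ _ hex i
      generalize Nat.find hex = i at *
      rcases Nat.eq_zero_or_pos i with rfl | hi
      · have : 0 < a → e ≤ a * e := fun h => Nat.le_mul_of_pos_left _ h
        rcases Nat.eq_zero_or_pos a with rfl | h0
        · simp at *; omega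
        · have := this h0
          omega
      · apply key i
        · have := hm (i - 1) (by omega)
          rw [Nat.sub_add_cancel hi] at this
          omega
        · have h4 : 2 * e ≤ i * e * e := by
            have : 1 * e ≤ i * e := Nat.mul_le_mul_right _ hi
            have : 2 * e ≤ (i * e) * e := Nat.mul_le_mul_right _ (by omega)
            exact this
          rw [add_mul] at hs
          rw [add_mul]
          have : 0 ≤ a * e := Nat.zero_le _
          omega

lemma Bset_small (e : ℕ) (he : 2 ≤ e) : 1 ∈ Bset (e + 2) ∧ 3 ∈ Bset (e + 2) := by
  constructor
  · exact Or.inl ⟨0, 1, by omega, by omega, by simp, by simp⟩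
  · exact Or.inl ⟨0, 2, by omega, by omega, by simp, by simp⟩

lemma Bset_odd (e n : ℕ) (h : n ∈ Bset (e + 2)) : n % 2 = 1 := by
  rcases h with ⟨s, t, _, _, h3, rfl⟩ | h | h
  · have h1 : e + 2 - 1 = e + 1 := by omega
    rw [h1]
    have : 0 < s * (e + 1) + t := by
      by_contra h
      have h5 : s * (e + 1) + t = 0 := by omega
      have : s = 0 := by nlinarith
      subst this
      simp_all
    rw [mul_assoc]
    omega
  · have : (e + 2) ^ 2 = e * e + 4 * e + 4 := by ring
    rw [h, this]; omega
  · have h' : n = 2 * (e + 2) ^ 2 - 3 := h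
    have : (e + 2) ^ 2 = e * e + 4 * e + 4 := by ring
    rw [h', this]; omega

lemma Bset_char (e a b : ℕ) (he : 2 ≤ e) (ha : a < e) :
    5 + 2 * (a + b * e) ∈ Bset (e + 2) ↔
    ¬ (a + 4 ≤ b ∧ ¬ (a = 0 ∧ (b = e + 3 ∨ b = e + 4))) := by
  have uniq : ∀ a' b', a' < e → a + b * e = a' + b' * e → a = a' ∧ b = b' := by
    intro a' b' ha' h
    have e1 : a = a' := by
      have := congrArg (· % e) h
      simpa [Nat.add_mod, Nat.mod_eq_of_lt ha, Nat.mod_eq_of_lt ha'] using this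
    subst e1
    exact ⟨rfl, Nat.eq_of_mul_eq_mul_right (by omega) (by omega : b * e = b' * e)⟩
  have hsq : (e + 2) ^ 2 = e * e + 4 * e + 4 := by ring
  have q1 : 2 * (e + 2) ^ 2 - 2 * (e + 2) + 1 = 5 + 2 * (0 + (e + 3) * e) := by
    rw [hsq, add_mul]; omega
  have q2 : 2 * (e + 2) ^ 2 - 3 = 5 + 2 * (0 + (e + 4) * e) := by
    rw [hsq, add_mul]; omega
  have h1 : e + 2 - 1 = e + 1 := by omega
  constructor
  · rintro (⟨s, t, hs, ht, h3, h⟩ | h | h)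
    · rw [h1] at h
      have ht1 : t ≤ e := by omega
      have ht2 : t ≤ e + 2 - s := by omega
      have h' : a + b * e + 3 = s * e + s + t := by
        have hs1 : s * (e + 1) = s * e + s := by ring
        rw [mul_assoc, hs1] at h
        omega
      by_cases hst : 3 ≤ s + t
      · obtain ⟨h5, h6⟩ := uniq (s + t - 3) s (by omega) (by omega)
        omega
      · rcases s with _ | s
        · omega
        · rw [add_mul] at h'
          obtain ⟨h5, h6⟩ := uniq (e + (s + 1) + t - 3) s (by omega) (by omega)
          omega
    · rw [q1] at h
      have := uniq 0 (e + 3) (by omega) (by omega)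
      omega
    · have h' : 5 + 2 * (a + b * e) = 2 * (e + 2) ^ 2 - 3 := h
      rw [q2] at h'
      have := uniq 0 (e + 4) (by omega) (by omega)
      omega
  · intro h
    by_cases hb : a + 4 ≤ b
    · have h5 : a = 0 ∧ (b = e + 3 ∨ b = e + 4) := by tauto
      obtain ⟨rfl, rfl | rfl⟩ := h5
      · exact Or.inr (Or.inl q1.symm)
      · exact Or.inr (Or.inr q2.symm)
    · left
      have key : ∀ s t, s ≤ e + 2 → t ≤ e → t ≤ e + 2 - s → 
          a + b * e + 3 = s * e + s + t → ∃ s t : ℕ, s ≤ e + 2 ∧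
          t ≤ min (e + 2 - 2) (e + 2 - s) ∧ (s, t) ≠ (0, 0) ∧
          5 + 2 * (a + b * e) = 2 * s * (e + 2 - 1) + 2 * t - 1 := by
        intro s t p1 p2 p3 p4
        refine ⟨s, t, p1, by omega, ?_, ?_⟩
        · intro h
          simp only [Prod.mk.injEq] at h
          obtain ⟨rfl, rfl⟩ := h
          omega
        · have hs1 : s * (e + 1) = s * e + s := by ring
          rw [h1, mul_assoc 2 s, hs1]
          omega
      by_cases ht : a + 3 - b ≤ e
      · exact key b (a + 3 - b) (by omega) ht (by omega) (by omega)
      · refine key (b + 1) (a + 3 - b - (e + 1)) (by omega) (by omega) (by omega) ?_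
        rw [add_mul]
        omega

/-- Theorem 1.2(b)(i), gap-set description: the complement of `S_b` in `ℕ` is the
union of the even numbers `2m` with `m ∉ H_d` and the set `B_d`. -/
theorem stmt_1 (d : ℕ) (hd : 4 ≤ d) :
    {n : ℕ | n ∉ Sb d} = {n : ℕ | ∃ m : ℕ, m ∉ Hd d ∧ n = 2 * m} ∪ Bset d := by
  obtain ⟨e, rfl⟩ : ∃ e, d = e + 2 := ⟨d - 2, by omega⟩
  have he : 2 ≤ e := by omega
  ext n
  simp only [Set.mem_ofPred_eq, Set.mem_union]
  rw [Sb_char e n he]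
  rcases Nat.even_or_odd' n with ⟨m, rfl | rfl⟩
  · have hB : 2 * m ∉ Bset (e + 2) := fun h => by
      have := Bset_odd e _ h
      omega
    constructor
    · intro h
      exact Or.inl ⟨m, fun hm => h (Or.inl ⟨m, hm, rfl⟩), rfl⟩
    · rintro (⟨m', hm, h⟩ | h)
      · have : m = m' := by omega
        subst this
        rintro (⟨h', hh, h2⟩ | ⟨y, _, h2⟩)
        · have : m = h' := by omega
          subst this
          exact hm hh
        · omega
      · exact absurd h hB
  · have hE : ¬ ∃ m', m' ∉ Hd (e + 2) ∧ 2 * m + 1 = 2 * m' := by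
      rintro ⟨m', _, h⟩
      omega
    have hE' : ¬ ∃ m', m' ∈ Hd (e + 2) ∧ 2 * m + 1 = 2 * m' := by
      rintro ⟨m', _, h⟩
      omega
    simp only [hE, hE', false_or]
    obtain ⟨b1, b3⟩ := Bset_small e he
    by_cases hm : m < 2
    · have h5 : ¬ ∃ y, TT e y ∧ 2 * m + 1 = 5 + 2 * y := by
        rintro ⟨y, _, h⟩
        omega
      simp only [h5, not_false_eq_true, true_iff]
      interval_cases m
      · exact b1
      · exact b3
    · obtain ⟨a, b, ha, hab⟩ : ∃ a b, a < e ∧ m = 2 + (a + b * e) := by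
        refine ⟨(m - 2) % e, (m - 2) / e, Nat.mod_lt _ (by omega), ?_⟩
        have := Nat.mod_add_div' (m - 2) e
        omega
      have h6 : 2 * m + 1 = 5 + 2 * (a + b * e) := by omega
      rw [h6, Bset_char e a b he ha, ← TT_char e a b he ha]
      refine not_congr ⟨?_, fun h => ⟨_, h, rfl⟩⟩
      rintro ⟨y, hy, h⟩
      have : y = a + b * e := by omega
      rwa [← this]
end

section
/- Let d ≥ 4 be an integer. Then the complement in ℕ of the additive submonoid S_c equals the union of {2m : m ∈ ℕ \ H_d} with the set C_d = {2s(d-1)+2t+1 : s,t ∈ ℕ, s ≤ d, t ≤ min(d-2, d-s)} ∪ {2d²-2d+3}. -/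
/-- Base-`e` description of `Hd (e+1)`. -/
def PH (e m : ℕ) : Prop := ∃ q t : ℕ, t < e ∧ m = q * e + t ∧ (t = 0 ∨ e ≤ q + t)

/-- Base-`e` description of the odd part. -/
def PD (e x : ℕ) : Prop :=
  ∃ q t : ℕ, t < e ∧ x = q * e + t ∧ e + 2 ≤ q + t ∧ ¬ (q = e + 1 ∧ t = 1)

theorem rep_unique {e q t q' t' : ℕ} (ht : t < e) (ht' : t' < e)
    (h : q * e + t = q' * e + t') : q = q' ∧ t = t' := by
  have h1 : (q * e + t) / e = q := by
    rw [mul_comm, Nat.mul_add_div (by omega), Nat.div_eq_of_lt ht]; rfl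
  have h2 : (q' * e + t') / e = q' := by
    rw [mul_comm, Nat.mul_add_div (by omega), Nat.div_eq_of_lt ht']; rfl
  have h3 : q = q' := by rw [← h1, h, h2]
  subst h3
  exact ⟨rfl, by omega⟩

theorem rep_exists {e : ℕ} (he : 0 < e) (x : ℕ) : ∃ q t : ℕ, t < e ∧ x = q * e + t :=
  ⟨x / e, x % e, Nat.mod_lt _ he, by rw [mul_comm]; exact (Nat.div_add_mod x e).symm⟩

theorem PH_add {e a b : ℕ} (ha : PH e a) (hb : PH e b) : PH e (a + b) := by
  obtain ⟨q, t, ht, rfl, h⟩ := ha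
  obtain ⟨q', t', ht', rfl, h'⟩ := hb
  by_cases hc : t + t' < e
  · exact ⟨q + q', t + t', hc, by ring, by omega⟩
  · obtain ⟨u, hu⟩ : ∃ u, t + t' = e + u := ⟨t + t' - e, by omega⟩
    refine ⟨q + q' + 1, u, by omega, by linear_combination hu, by omega⟩

theorem PD_add {e a b : ℕ} (ha : PD e a) (hb : PH e b) : PD e (a + b) := by
  obtain ⟨q, t, ht, rfl, h, hn⟩ := ha
  obtain ⟨q', t', ht', rfl, h'⟩ := hb
  by_cases hc : t + t' < e
  · exact ⟨q + q', t + t', hc, by ring, by omega, by omega⟩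
  · obtain ⟨u, hu⟩ : ∃ u, t + t' = e + u := ⟨t + t' - e, by omega⟩
    refine ⟨q + q' + 1, u, by omega, by linear_combination hu, by omega, by omega⟩

theorem PD_add_PD {e a b : ℕ} (ha : PD e a) (hb : PD e b) : PH e (a + b + 1) := by
  obtain ⟨q, t, ht, rfl, h, hn⟩ := ha
  obtain ⟨q', t', ht', rfl, h', hn'⟩ := hb
  by_cases hc : t + t' + 1 < e
  · exact ⟨q + q', t + t' + 1, hc, by ring, by omega⟩
  · obtain ⟨u, hu⟩ : ∃ u, t + t' + 1 = e + u := ⟨t + t' + 1 - e, by omega⟩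
    refine ⟨q + q' + 1, u, by omega, by linear_combination hu, by omega⟩

theorem gen_mem_Hd {e r : ℕ} (hr : r ≤ e - 1) : e + r * (e - 1) ∈ Hd (e + 1) :=
  AddSubmonoid.subset_closure ⟨r, by omega, by simp⟩

theorem mul_mem_Hd (e k : ℕ) : k * e ∈ Hd (e + 1) := by
  have h := gen_mem_Hd (e := e) (r := 0) (by omega)
  simpa using AddSubmonoid.nsmul_mem _ h k

theorem mem_Hd_iff_s2 {e : ℕ} (he : 3 ≤ e) (m : ℕ) : m ∈ Hd (e + 1) ↔ PH e m := by
  constructor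
  · intro hm
    unfold Hd at hm
    induction hm using AddSubmonoid.closure_induction with
    | mem x hx =>
      obtain ⟨r, hr, rfl⟩ := hx
      rcases Nat.eq_zero_or_pos r with rfl | hp
      · exact ⟨1, 0, by omega, by simp, by simp⟩
      · obtain ⟨k, rfl⟩ : ∃ k, e = r + k := ⟨e - r, by omega⟩
        refine ⟨r, k, by omega, ?_, by omega⟩
        obtain ⟨f, hf⟩ : ∃ f, r + k = f + 1 := ⟨r + k - 1, by omega⟩
        have h1 : r + k + 1 - 1 = r + k := by omega
        have h2 : r + k + 1 - 2 = f := by omega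
        rw [h1, h2, hf]
        linear_combination hf.symm
    | zero => exact ⟨0, 0, by omega, by simp, by simp⟩
    | add x y _ _ hx hy => exact PH_add hx hy
  · rintro ⟨q, t, ht, rfl, h⟩
    rcases Nat.eq_zero_or_pos t with rfl | hp
    · exact mul_mem_Hd e q
    · obtain ⟨r, hr⟩ : ∃ r, e = r + t := ⟨e - t, by omega⟩
      obtain ⟨k, hk⟩ : ∃ k, q = r + k := ⟨q - r, by omega⟩
      have := add_mem (gen_mem_Hd (e := e) (r := r) (by omega)) (mul_mem_Hd e k)
      convert this using 1
      obtain ⟨f, hf⟩ : ∃ f, e = f + 1 := ⟨e - 1, by omega⟩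
      have h1 : e - 1 = f := by omega
      rw [h1, hk]
      linear_combination r * hf - hr

theorem gen_mem_Sc {e t : ℕ} (he : 3 ≤ e) (h2 : 2 ≤ t) (ht : t < e) :
    2 * ((e + 2 - t) * e + t) + 1 ∈ Sc (e + 1) := by
  refine AddSubmonoid.subset_closure (Or.inl (Or.inr ⟨e - 1 - t, by omega, ?_⟩))
  obtain ⟨r, rfl⟩ : ∃ r, e = r + t + 1 := ⟨e - 1 - t, by omega⟩
  have h1 : r + t + 1 + 2 - t = r + 3 := by omega
  have h3 : r + t + 1 - 1 - t = r := by omega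
  have h4 : r + t + 1 + 1 - 2 = r + t := by omega
  have h5 : 8 * (r + t + 1 + 1) - 9 = 8 * r + 8 * t + 7 := by omega
  rw [h1, h3, h4, h5]
  ring

theorem even_mem_Sc {e h : ℕ} (hh : h ∈ Hd (e + 1)) : 2 * h ∈ Sc (e + 1) :=
  AddSubmonoid.subset_closure (Or.inl (Or.inl ⟨h, hh, rfl⟩))

theorem last_gen (e : ℕ) : 2 * (e + 1) ^ 2 - 1 = 2 * ((e + 2) * e) + 1 := by
  have : 2 * (e + 1) ^ 2 = 2 * ((e + 2) * e) + 2 := by ring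
  omega

theorem last_mem_Sc (e : ℕ) : 2 * ((e + 2) * e) + 1 ∈ Sc (e + 1) :=
  AddSubmonoid.subset_closure (Or.inr (last_gen e).symm)

theorem odd_mem_Sc {e x : ℕ} (he : 3 ≤ e) (hx : PD e x) : 2 * x + 1 ∈ Sc (e + 1) := by
  obtain ⟨q, t, ht, rfl, h, hn⟩ := hx
  by_cases h2 : 2 ≤ t
  · obtain ⟨k, hk⟩ : ∃ k, q = (e + 2 - t) + k := ⟨q - (e + 2 - t), by omega⟩
    have := add_mem (gen_mem_Sc he h2 ht) (even_mem_Sc (mul_mem_Hd e k))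
    convert this using 1
    rw [hk]; ring
  · obtain ⟨k, hk⟩ : ∃ k, q = e + 2 + k := ⟨q - (e + 2), by omega⟩
    have h01 : t = 0 ∨ t = 1 := by omega
    rcases h01 with rfl | rfl
    · have := add_mem (last_mem_Sc e) (even_mem_Sc (mul_mem_Hd e k))
      convert this using 1
      rw [hk]; ring
    · have := add_mem (add_mem (gen_mem_Sc he le_rfl (by omega))
        (even_mem_Sc (gen_mem_Hd (e := e) (r := 1) (by omega))))
        (even_mem_Sc (mul_mem_Hd e k))
      convert this using 1
      obtain ⟨f, rfl⟩ : ∃ f, e = f + 1 := ⟨e - 1, by omega⟩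
      have h1 : f + 1 + 2 - 2 = f + 1 := by omega
      have h3 : f + 1 - 1 = f := by omega
      rw [hk, h1, h3]; ring

theorem Sc_sub {e n : ℕ} (he : 3 ≤ e) (hn : n ∈ Sc (e + 1)) :
    (∃ m, PH e m ∧ n = 2 * m) ∨ (∃ x, PD e x ∧ n = 2 * x + 1) := by
  unfold Sc at hn
  induction hn using AddSubmonoid.closure_induction with
  | mem x hx =>
    rcases hx with (⟨h, hh, rfl⟩ | ⟨r, hr, rfl⟩) | hx
    · exact Or.inl ⟨h, (mem_Hd_iff_s2 he h).1 hh, rfl⟩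
    · right
      obtain ⟨t, rfl⟩ : ∃ t, e = r + t + 1 := ⟨e - 1 - r, by omega⟩
      refine ⟨(r + 3) * (r + t + 1) + t, ⟨r + 3, t, by omega, rfl, by omega, by omega⟩, ?_⟩
      have h4 : r + t + 1 + 1 - 2 = r + t := by omega
      have h5 : 8 * (r + t + 1 + 1) - 9 = 8 * r + 8 * t + 7 := by omega
      rw [h4, h5]
      ring
    · right
      have hx' : x = 2 * (e + 1) ^ 2 - 1 := hx
      exact ⟨(e + 2) * e, ⟨e + 2, 0, by omega, rfl, by omega, by omega⟩,
        by rw [hx', last_gen]⟩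
  | zero => exact Or.inl ⟨0, ⟨0, 0, by omega, by simp, by simp⟩, rfl⟩
  | add x y _ _ hx hy =>
    rcases hx with ⟨a, ha, rfl⟩ | ⟨a, ha, rfl⟩ <;> rcases hy with ⟨b, hb, rfl⟩ | ⟨b, hb, rfl⟩
    · exact Or.inl ⟨a + b, PH_add ha hb, by ring⟩
    · exact Or.inr ⟨b + a, PD_add hb ha, by ring⟩
    · exact Or.inr ⟨a + b, PD_add ha hb, by ring⟩
    · exact Or.inl ⟨a + b + 1, PD_add_PD ha hb, by ring⟩

theorem Cset_iff {e : ℕ} (he : 3 ≤ e) (n : ℕ) :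
    n ∈ Cset (e + 1) ↔ ∃ x, ¬ PD e x ∧ n = 2 * x + 1 := by
  have hlast : 2 * (e + 1) ^ 2 - 2 * (e + 1) + 3 = 2 * ((e + 1) * e + 1) + 1 := by
    have : 2 * (e + 1) ^ 2 = 2 * ((e + 1) * e) + 2 * (e + 1) := by ring
    omega
  constructor
  · rintro (⟨s, t, hs, ht, rfl⟩ | hn)
    · have ht1 := le_trans ht (min_le_left _ _)
      have ht2 := le_trans ht (min_le_right _ _)
      refine ⟨s * e + t, ?_, by rw [Nat.add_sub_cancel]; ring⟩
      rintro ⟨q, t', ht', h, h', -⟩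
      obtain ⟨rfl, rfl⟩ := rep_unique (by omega) ht' h
      omega
    · refine ⟨(e + 1) * e + 1, ?_, ?_⟩
      · rintro ⟨q, t', ht', h, h', hne⟩
        obtain ⟨rfl, rfl⟩ := rep_unique (by omega) ht' h
        exact hne ⟨rfl, rfl⟩
      · rw [← hlast]; exact hn
  · rintro ⟨x, hx, rfl⟩
    obtain ⟨q, t, ht, rfl⟩ := rep_exists (e := e) (by omega) x
    by_cases hc : q = e + 1 ∧ t = 1
    · right
      obtain ⟨rfl, rfl⟩ := hc
      exact hlast.symm
    · left
      have : ¬ (e + 2 ≤ q + t) := fun h => hx ⟨q, t, ht, rfl, h, hc⟩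
      exact ⟨q, t, by omega, le_min (by omega) (by omega), by rw [Nat.add_sub_cancel]; ring⟩

/-- Theorem 1.2(c), gap-set description: the complement of `S_c` in `ℕ` is the
union of the even numbers `2m` with `m ∉ H_d` and the set `C_d`. -/
theorem stmt_2 (d : ℕ) (hd : 4 ≤ d) :
    {n : ℕ | n ∉ Sc d} = {n : ℕ | ∃ m : ℕ, m ∉ Hd d ∧ n = 2 * m} ∪ Cset d := by
  obtain ⟨e, rfl⟩ : ∃ e, d = e + 1 := ⟨d - 1, by omega⟩
  have he : 3 ≤ e := by omega
  ext n
  simp only [Set.mem_ofPred_eq, Set.mem_union, Cset_iff he]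
  constructor
  · intro hn
    rcases Nat.even_or_odd' n with ⟨m, rfl | rfl⟩
    · exact Or.inl ⟨m, fun h => hn (even_mem_Sc h), rfl⟩
    · exact Or.inr ⟨m, fun h => hn (odd_mem_Sc he h), rfl⟩
  · rintro (⟨m, hm, rfl⟩ | ⟨m, hm, rfl⟩) hn
    · rcases Sc_sub he hn with ⟨a, ha, h⟩ | ⟨a, ha, h⟩
      · obtain rfl : m = a := by omega
        exact hm ((mem_Hd_iff_s2 he m).2 ha)
      · omega
    · rcases Sc_sub he hn with ⟨a, ha, h⟩ | ⟨a, ha, h⟩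
      · omega
      · obtain rfl : m = a := by omega
        exact hm ha
end

section
/- Let d ≥ 4 be an integer. Then the set A_d = {2s(d-1)+2t+1 : s,t ∈ ℕ, s ≤ d, t ≤ min(d-2, d-s)} ∪ {2d²-1} is finite and has cardinality (d²+3d-2)/2. -/
lemma sum_min_aux (n : ℕ) :
    2 * ∑ s ∈ Finset.range (n + 5), (min (n + 2) (n + 4 - s) + 1) = (n + 4) ^ 2 + 3 * (n + 4) - 4 := by
  have h : ∀ m : ℕ, 2 * ∑ i ∈ Finset.range m, (m - i) = m ^ 2 + m := by
    intro m
    induction m with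
    | zero => simp
    | succ k ih =>
      rw [Finset.sum_range_succ']
      simp only [Nat.add_sub_add_right, Nat.sub_zero]
      rw [mul_add, ih]; ring
  rw [show n + 5 = (n + 3) + 1 + 1 by ring, Finset.sum_range_succ', Finset.sum_range_succ']
  have h2 : ∑ i ∈ Finset.range (n + 3), (min (n + 2) (n + 4 - (i + 1 + 1)) + 1)
      = ∑ i ∈ Finset.range (n + 3), (n + 3 - i) := by
    apply Finset.sum_congr rfl
    intro i hi
    have := Finset.mem_range.1 hi
    omega
  rw [h2]
  have h3 := h (n + 3)
  have e1 : min (n + 2) (n + 4 - (0 + 1)) = n + 2 := by omega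
  have e2 : min (n + 2) (n + 4 - 0) = n + 2 := by omega
  rw [e1, e2]
  have e3 : (n + 4) ^ 2 = (n + 3) ^ 2 + 2 * n + 7 := by ring
  omega

lemma inj_aux (k s t s' t' : ℕ) (ht : t < k) (ht' : t' < k)
    (h : 2 * s * k + 2 * t + 1 = 2 * s' * k + 2 * t' + 1) : s = s' ∧ t = t' := by
  have h1 : t + k * s = t' + k * s' := by nlinarith
  have hk : 0 < k := by omega
  have hs : s = s' := by
    have := congrArg (· / k) h1
    simpa [Nat.add_mul_div_left _ _ hk, Nat.div_eq_of_lt ht, Nat.div_eq_of_lt ht'] using this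
  subst hs
  exact ⟨rfl, by omega⟩

/-- The set `A_d` is finite of cardinality `(d²+3d-2)/2`. -/
theorem stmt_3 (d : ℕ) (hd : 4 ≤ d) :
    (Aset d).Finite ∧ (Aset d).ncard = (d ^ 2 + 3 * d - 2) / 2 := by
  obtain ⟨n, rfl⟩ : ∃ n, d = n + 4 := ⟨d - 4, by omega⟩
  let P : Finset (Σ _ : ℕ, ℕ) :=
    (Finset.range (n + 5)).sigma (fun s => Finset.range (min (n + 2) (n + 4 - s) + 1))
  let f : (Σ _ : ℕ, ℕ) → ℕ := fun p => 2 * p.1 * (n + 3) + 2 * p.2 + 1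
  have hA : Aset (n + 4) = ((insert (2 * (n + 4) ^ 2 - 1) (P.image f) : Finset ℕ) : Set ℕ) := by
    ext x
    simp only [Aset, P, f, Set.mem_union, Set.mem_setOf_eq, Set.mem_singleton_iff,
      Finset.coe_insert, Set.mem_insert_iff, Finset.mem_coe, Finset.mem_image, Finset.mem_sigma,
      Finset.mem_range]
    constructor
    · rintro (⟨s, t, h1, h2, h3⟩ | h)
      · right
        refine ⟨⟨s, t⟩, ⟨by simp only; omega, by simp only; omega⟩, h3.symm⟩
      · left; exact h
    · rintro (h | ⟨⟨s, t⟩, ⟨h1, h2⟩, h3⟩)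
      · right; exact h
      · left
        simp only at h1 h2
        exact ⟨s, t, by omega, by omega, h3.symm⟩
  have hinj : Set.InjOn f (P : Set (Σ _ : ℕ, ℕ)) := by
    rintro ⟨s, t⟩ h ⟨s', t'⟩ h' he
    simp only [P, Finset.mem_coe, Finset.mem_sigma, Finset.mem_range] at h h'
    obtain ⟨rfl, rfl⟩ := inj_aux (n + 3) s t s' t' (by omega) (by omega) he
    rfl
  have hnot : 2 * (n + 4) ^ 2 - 1 ∉ P.image f := by
    simp only [P, f, Finset.mem_image, Finset.mem_sigma, Finset.mem_range]
    rintro ⟨⟨s, t⟩, ⟨h1, h2⟩, h3⟩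
    simp only at h1 h2 h3
    have a1 : t + s ≤ n + 4 := by omega
    have a2 : s * (n + 3) + t ≤ (n + 4) * (n + 3) := by
      have : s * (n + 2) ≤ (n + 4) * (n + 2) := Nat.mul_le_mul_right _ (by omega)
      nlinarith
    have a3 : 2 * s * (n + 3) = 2 * (s * (n + 3)) := by ring
    have a4 : 2 * (n + 4) ^ 2 = 2 * ((n + 4) * (n + 3)) + 2 * (n + 4) := by ring
    omega
  rw [hA]
  refine ⟨Finset.finite_toSet _, ?_⟩
  rw [Set.ncard_coe_finset, Finset.card_insert_of_notMem hnot, Finset.card_image_of_injOn hinj,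
    Finset.card_sigma]
  simp only [Finset.card_range]
  have := sum_min_aux n
  omega
end

section
/- Let d ≥ 4 be an integer. Then the set B_d = {2s(d-1)+2t-1 : s,t ∈ ℕ, s ≤ d, t ≤ min(d-2, d-s), (s,t) ≠ (0,0)} ∪ {2d²-2d+1, 2d²-3} is finite and has cardinality (d²+3d-2)/2. -/
/-- Number of admissible `t` for each `s` (including the two extra points). -/
def cB (d s : ℕ) : ℕ :=
  if s ≤ 1 then d - 1 else if s ≤ d - 1 then d + 1 - s else if s = d then 2 else 1

/-- Finset of index pairs, including `(0,0)`. -/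
def PB (d : ℕ) : Finset (Σ _ : ℕ, ℕ) :=
  (Finset.range (d + 2)).sigma (fun s => Finset.range (cB d s))

theorem cB_le (d s : ℕ) (hd : 4 ≤ d) : cB d s ≤ d - 1 := by
  unfold cB; split_ifs <;> omega

theorem sum_aux (k : ℕ) : 2 * ∑ i ∈ Finset.range k, (k + 1 - i) = k * (k + 3) := by
  induction k with
  | zero => simp
  | succ n ih =>
    rw [Finset.sum_range_succ']
    have : ∑ i ∈ Finset.range n, (n + 1 + 1 - (i + 1)) = ∑ i ∈ Finset.range n, (n + 1 - i) :=
      Finset.sum_congr rfl (fun i _ => by omega)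
    rw [this, mul_add, ih]
    simp only [Nat.sub_zero]
    ring

theorem PB_card (d : ℕ) (hd : 4 ≤ d) : 2 * (PB d).card = d ^ 2 + 3 * d := by
  obtain ⟨k, rfl⟩ : ∃ k, d = k + 2 := ⟨d - 2, by omega⟩
  unfold PB
  rw [Finset.card_sigma]
  simp only [Finset.card_range]
  rw [show k + 2 + 2 = k + 1 + 1 + 1 + 1 by ring, Finset.sum_range_succ, Finset.sum_range_succ,
    Finset.sum_range_succ', Finset.sum_range_succ']
  have h1 : ∑ i ∈ Finset.range k, cB (k + 2) (i + 1 + 1) = ∑ i ∈ Finset.range k, (k + 1 - i) := by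
    refine Finset.sum_congr rfl (fun i hi => ?_)
    rw [Finset.mem_range] at hi
    unfold cB; split_ifs <;> omega
  have h2 : cB (k + 2) (0 + 1) = k + 1 := by unfold cB; split_ifs <;> omega
  have h3 : cB (k + 2) 0 = k + 1 := by unfold cB; split_ifs <;> omega
  have h4 : cB (k + 2) (k + 1 + 1) = 2 := by unfold cB; split_ifs <;> omega
  have h5 : cB (k + 2) (k + 1 + 1 + 1) = 1 := by unfold cB; split_ifs <;> omega
  rw [h1, h2, h3, h4, h5]
  have := sum_aux k
  nlinarith

/-- The parametrization. -/
def fB (d : ℕ) (p : Σ _ : ℕ, ℕ) : ℕ := 2 * p.1 * (d - 1) + 2 * p.2 - 1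

theorem fB_inj (d : ℕ) (hd : 4 ≤ d) : Set.InjOn (fB d) (PB d) := by
  rintro ⟨s, t⟩ h ⟨s', t'⟩ h' e
  simp only [PB, Finset.coe_sigma, Set.mem_sigma_iff, Finset.coe_range, Set.mem_Iio] at h h'
  have ht := lt_of_lt_of_le h.2 (cB_le d s hd)
  have ht' := lt_of_lt_of_le h'.2 (cB_le d s' hd)
  simp only [fB, mul_assoc] at e
  have e2 : s * (d - 1) + t = s' * (d - 1) + t' := by omega
  have hs : s = s' := by
    have := congrArg (· / (d - 1)) e2
    rwa [add_comm, Nat.add_mul_div_right _ _ (by omega), add_comm (s' * _),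
      Nat.add_mul_div_right _ _ (by omega), Nat.div_eq_of_lt ht, Nat.div_eq_of_lt ht',
      zero_add, zero_add] at this
  subst hs
  have : t = t' := by omega
  rw [this]

theorem Bset_eq (d : ℕ) (hd : 4 ≤ d) :
    Bset d = ↑(((PB d).erase ⟨0, 0⟩).image (fB d)) := by
  have hd1 : 2 * d * (d - 1) + 2 * 1 - 1 = 2 * d ^ 2 - 2 * d + 1 := by
    have : 2 * d * (d - 1) = 2 * d ^ 2 - 2 * d := by rw [Nat.mul_sub]; congr 1 <;> ring
    omega
  have hd2 : 2 * (d + 1) * (d - 1) + 2 * 0 - 1 = 2 * d ^ 2 - 3 := by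
    obtain ⟨k, rfl⟩ : ∃ k, d = k + 1 := ⟨d - 1, by omega⟩
    have : 2 * (k + 1) ^ 2 = 2 * (k + 1 + 1) * (k + 1 - 1) + 2 := by
      simp only [Nat.add_sub_cancel]; ring
    omega
  ext x
  simp only [Bset, Set.mem_union, Set.mem_ofPred_eq, Set.mem_insert_iff, Set.mem_singleton_iff,
    Finset.coe_image, Set.mem_image, Finset.mem_coe, Finset.mem_erase, PB, Finset.mem_sigma,
    Finset.mem_range, Sigma.exists, fB, ne_eq, Sigma.mk.injEq, heq_eq_eq, Prod.mk.injEq]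
  constructor
  · rintro (⟨s, t, hs, ht, h0, rfl⟩ | rfl | rfl)
    · refine ⟨s, t, ⟨h0, by omega, ?_⟩, rfl⟩
      unfold cB; split_ifs <;> omega
    · refine ⟨d, 1, ⟨by omega, by omega, ?_⟩, hd1⟩
      unfold cB; split_ifs <;> omega
    · refine ⟨d + 1, 0, ⟨by omega, by omega, ?_⟩, hd2⟩
      unfold cB; split_ifs <;> omega
  · rintro ⟨s, t, ⟨h0, hs, ht⟩, rfl⟩
    by_cases c1 : s = d ∧ t = 1
    · obtain ⟨rfl, rfl⟩ := c1
      exact Or.inr (Or.inl hd1)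
    by_cases c2 : s = d + 1
    · subst c2
      have : t = 0 := by unfold cB at ht; split_ifs at ht <;> omega
      subst this
      exact Or.inr (Or.inr hd2)
    refine Or.inl ⟨s, t, by omega, ?_, h0, rfl⟩
    unfold cB at ht; split_ifs at ht <;> omega

/-- The set `B_d` is finite of cardinality `(d²+3d-2)/2`. -/
theorem stmt_4 (d : ℕ) (hd : 4 ≤ d) :
    (Bset d).Finite ∧ (Bset d).ncard = (d ^ 2 + 3 * d - 2) / 2 := by
  rw [Bset_eq d hd]
  refine ⟨Finset.finite_toSet _, ?_⟩
  rw [Set.ncard_coe_finset, Finset.card_image_of_injOn, Finset.card_erase_of_mem]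
  · have := PB_card d hd
    omega
  · simp only [PB, Finset.mem_sigma, Finset.mem_range]
    refine ⟨by omega, ?_⟩
    unfold cB; split_ifs <;> omega
  · exact (fB_inj d hd).mono (by
      intro x hx
      exact Finset.mem_of_mem_erase hx)
end

section
/- Let d ≥ 4 be an integer. Then every odd natural number m with m < 8d-9 belongs to the set A_d = {2s(d-1)+2t+1 : s,t ∈ ℕ, s ≤ d, t ≤ min(d-2, d-s)} ∪ {2d²-1}, while 8d-9 does not belong to A_d. In other words, 8d-9 is the smallest odd natural number not in A_d. -/
/-- `8d-9` is the smallest odd natural number not in `A_d`. -/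
theorem stmt_5 (d : ℕ) (hd : 4 ≤ d) :
    (∀ m : ℕ, Odd m → m < 8 * d - 9 → m ∈ Aset d) ∧ 8 * d - 9 ∉ Aset d := by
  obtain ⟨e, rfl⟩ : ∃ e, d = e + 4 := ⟨d - 4, by omega⟩
  have e1 : e + 4 - 1 = e + 3 := by omega
  constructor
  · rintro m ⟨k, rfl⟩ hm
    left
    have key : ∀ s t : ℕ, s ≤ 3 → t ≤ e + 2 → t ≤ e + 4 - s → k = s * (e + 3) + t →
        ∃ s t : ℕ, s ≤ e + 4 ∧ t ≤ min (e + 4 - 2) (e + 4 - s) ∧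
          2 * k + 1 = 2 * s * (e + 4 - 1) + 2 * t + 1 := by
      intro s t hs ht ht' hk
      refine ⟨s, t, by omega, le_min (by omega) ht', ?_⟩
      rw [e1, hk]
      ring
    show ∃ s t : ℕ, _
    by_cases h1 : k < e + 3
    · exact key 0 k (by omega) (by omega) (by omega) (by omega)
    by_cases h2 : k < 2 * (e + 3)
    · exact key 1 (k - (e + 3)) (by omega) (by omega) (by omega) (by omega)
    by_cases h3 : k < 3 * (e + 3)
    · exact key 2 (k - 2 * (e + 3)) (by omega) (by omega) (by omega) (by omega)
    · exact key 3 (k - 3 * (e + 3)) (by omega) (by omega) (by omega) (by omega)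
  · rintro (⟨s, t, hs, ht, h⟩ | h)
    · rw [e1] at h
      have ht1 := le_trans ht (min_le_left _ _)
      have ht2 := le_trans ht (min_le_right _ _)
      by_cases h4 : 4 ≤ s
      · have := Nat.mul_le_mul_right (e + 3) (Nat.mul_le_mul_left 2 h4)
        omega
      · interval_cases s <;> omega
    · have h : 8 * (e + 4) - 9 = 2 * (e + 4) ^ 2 - 1 := h
      have h5 : 2 * (e + 4) ^ 2 = 2 * (e * e) + 16 * e + 32 := by ring
      rw [h5] at h
      omega
end

section
/- Let d ≥ 4 be an integer. Then every odd natural number m with 1 ≤ m < 8d-11 belongs to the set B_d = {2s(d-1)+2t-1 : s,t ∈ ℕ, s ≤ d, t ≤ min(d-2, d-s), (s,t) ≠ (0,0)} ∪ {2d²-2d+1, 2d²-3}, while 8d-11 does not belong to B_d. In other words, 8d-11 is the smallest odd natural number not in B_d. -/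
/-- `8d-11` is the smallest odd natural number not in `B_d`. -/
theorem stmt_6 (d : ℕ) (hd : 4 ≤ d) :
    (∀ m : ℕ, Odd m → 1 ≤ m → m < 8 * d - 11 → m ∈ Bset d) ∧ 8 * d - 11 ∉ Bset d := by
  obtain ⟨e, rfl⟩ : ∃ e, d = e + 4 := ⟨d - 4, by omega⟩
  constructor
  · rintro m ⟨k, rfl⟩ - hm
    left
    have h1 : e + 4 - 1 = e + 3 := by omega
    simp only [Set.mem_setOf_eq, ne_eq, Prod.mk.injEq, h1]
    by_cases c0 : k + 1 < e + 3
    · exact ⟨0, k + 1, by omega, by omega, by omega, by omega⟩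
    by_cases c1 : k + 1 < 2 * (e + 3)
    · exact ⟨1, k + 1 - (e + 3), by omega, by omega, by omega, by omega⟩
    by_cases c2 : k + 1 < 3 * (e + 3)
    · exact ⟨2, k + 1 - 2 * (e + 3), by omega, by omega, by omega, by omega⟩
    · exact ⟨3, k + 1 - 3 * (e + 3), by omega, by omega, by omega, by omega⟩
  · have h1 : e + 4 - 1 = e + 3 := by omega
    rintro (⟨s, t, hs, ht, -, h⟩ | h | h)
    · rw [h1] at h
      by_cases c : s ≤ 3
      · interval_cases s <;> omega
      · obtain ⟨u, rfl⟩ : ∃ u, s = u + 4 := ⟨s - 4, by omega⟩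
        have h2 : 2 * (u + 4) * (e + 3) = 2 * (u * (e + 3)) + 8 * e + 24 := by ring
        omega
    · have h2 : (e + 4) ^ 2 = e * e + 8 * e + 16 := by ring
      rw [h2] at h
      omega
    · have h3 : 8 * (e + 4) - 11 = 2 * (e + 4) ^ 2 - 3 := h
      have h2 : (e + 4) ^ 2 = e * e + 8 * e + 16 := by ring
      rw [h2] at h3
      omega
end

section
/- Let d ≥ 4 be an integer. Then every odd natural number m with m < 8d-9 belongs to the set C_d = {2s(d-1)+2t+1 : s,t ∈ ℕ, s ≤ d, t ≤ min(d-2, d-s)} ∪ {2d²-2d+3}, while 8d-9 does not belong to C_d. In other words, 8d-9 is the smallest odd natural number not in C_d. -/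
/-- `8d-9` is the smallest odd natural number not in `C_d`. -/
theorem stmt_7 (d : ℕ) (hd : 4 ≤ d) :
    (∀ m : ℕ, Odd m → m < 8 * d - 9 → m ∈ Cset d) ∧ 8 * d - 9 ∉ Cset d := by
  obtain ⟨n, rfl⟩ : ∃ n, d = n + 1 := ⟨d - 1, by omega⟩
  constructor
  · rintro m ⟨k, rfl⟩ hm
    left
    by_cases h1 : k < n
    · exact ⟨0, k, by omega, by omega, by simp⟩
    by_cases h2 : k < 2 * n
    · exact ⟨1, k - n, by omega, by omega, by simp only [Nat.add_sub_cancel]; omega⟩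
    by_cases h3 : k < 3 * n
    · exact ⟨2, k - 2 * n, by omega, by omega, by simp only [Nat.add_sub_cancel]; omega⟩
    · exact ⟨3, k - 3 * n, by omega, by omega, by simp only [Nat.add_sub_cancel]; omega⟩
  · rintro (⟨s, t, hs, ht, h⟩ | h)
    · simp only [Nat.add_sub_cancel] at h
      have ht1 : t ≤ n - 1 := by omega
      have ht2 : t ≤ n + 1 - s := by omega
      rcases Nat.lt_or_ge s 4 with h4 | h4
      · interval_cases s <;> omega
      · have : 4 * n ≤ s * n := Nat.mul_le_mul_right n h4
        rw [mul_assoc] at h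
        omega
    · have h : 8 * (n + 1) - 9 = 2 * (n + 1) ^ 2 - 2 * (n + 1) + 3 := h
      have h5 : 2 * (n + 1) ^ 2 = 2 * (n * n) + 4 * n + 2 := by ring
      have h6 : 3 * n ≤ n * n := Nat.mul_le_mul_right n (by omega)
      omega
end

section
/- Let d ≥ 4 be an integer. Then (d-3)(d-2) does not belong to H_d. -/
/-- `(d-3)(d-2) ∉ H_d`. -/
theorem stmt_10 (d : ℕ) (hd : 4 ≤ d) : (d - 3) * (d - 2) ∉ Hd d := by
  obtain ⟨m, rfl⟩ : ∃ m, d = m + 3 := ⟨d - 3, by omega⟩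
  have key : ∀ x ∈ Hd (m + 3), ∃ k R : ℕ, R ≤ (m + 1) * k ∧ x = k * (m + 2) + R * (m + 1) := by
    intro x hx
    unfold Hd at hx
    induction hx using AddSubmonoid.closure_induction with
    | mem x hx =>
      obtain ⟨r, hr, rfl⟩ := hx
      refine ⟨1, r, by omega, ?_⟩
      have h1 : m + 3 - 1 = m + 2 := by omega
      have h2 : m + 3 - 2 = m + 1 := by omega
      rw [h1, h2]; ring
    | zero => exact ⟨0, 0, by simp, by simp⟩
    | add x y _ _ ihx ihy =>
      obtain ⟨k, R, h, rfl⟩ := ihx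
      obtain ⟨k', R', h', rfl⟩ := ihy
      exact ⟨k + k', R + R', by rw [mul_add]; omega, by ring⟩
  intro hmem
  obtain ⟨k, R, hR, hx⟩ := key _ hmem
  have h1 : m + 3 - 3 = m := by omega
  have h2 : m + 3 - 2 = m + 1 := by omega
  rw [h1, h2] at hx
  have hdvd : (m + 1) ∣ k := by
    have h3 : (m + 1) ∣ (k + R) * (m + 1) + k := by
      have : (k + R) * (m + 1) + k = m * (m + 1) := by rw [hx]; ring
      rw [this]; exact Dvd.intro_left _ rfl
    exact (Nat.dvd_add_right (Dvd.intro_left _ rfl)).1 h3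
  rcases Nat.eq_zero_or_pos k with rfl | hk
  · have : R = 0 := by simpa using hR
    subst this
    have : 0 < m * (m + 1) := Nat.mul_pos (by omega) (by omega)
    omega
  · have := Nat.le_of_dvd hk hdvd
    nlinarith [Nat.zero_le (R * (m + 1))]
end

section
/- Let d ≥ 4 be an integer. Then (d-2)² does not belong to H_d. -/
/-- `(d-2)² ∉ H_d`. -/
theorem stmt_11 (d : ℕ) (hd : 4 ≤ d) : (d - 2) ^ 2 ∉ Hd d := by
  intro h
  obtain ⟨m, rfl⟩ : ∃ m, d = m + 2 := ⟨d - 2, by omega⟩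
  have key : ∀ x ∈ Hd (m + 2), ∃ k q : ℕ, x = k + m * q ∧ k ≤ q ∧ (k = 0 → q = 0) := by
    intro x hx
    unfold Hd at hx
    induction hx using AddSubmonoid.closure_induction with
    | mem x hx =>
      obtain ⟨r, _, rfl⟩ := hx
      refine ⟨1, r + 1, ?_, by omega, by omega⟩
      have h1 : m + 2 - 1 = m + 1 := by omega
      have h2 : m + 2 - 2 = m := by omega
      rw [h1, h2]
      ring
    | zero => exact ⟨0, 0, by simp, le_refl _, fun _ => rfl⟩
    | add x y _ _ hx hy =>
      obtain ⟨k, q, rfl, h1, h2⟩ := hx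
      obtain ⟨k', q', rfl, h3, h4⟩ := hy
      exact ⟨k + k', q + q', by ring, by omega, by omega⟩
  obtain ⟨k, q, he, hk, h0⟩ := key _ h
  have h2 : m + 2 - 2 = m := by omega
  rw [h2] at he
  have hm : 2 ≤ m := by omega
  have hdvd : m ∣ k := by
    have h5 : m ∣ k + m * q := he ▸ Dvd.intro_left (m ^ 1) (by ring)
    exact (Nat.dvd_add_left (Dvd.intro _ rfl)).1 h5
  rcases Nat.eq_zero_or_pos k with hz | hpos
  · have := h0 hz
    subst hz this
    simp at he
    omega
  · have h6 := Nat.le_of_dvd hpos hdvd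
    nlinarith [Nat.mul_le_mul_left m (h6.trans hk)]
end

section
/- Let d ≥ 4 be an integer. Then 2d² - 3 does not belong to the additive submonoid S_b. -/
theorem Hd_shape (m x : ℕ) (hx : x ∈ Hd (m + 2)) :
    ∃ a q : ℕ, x = a + m * q ∧ a ≤ q ∧ (a = 0 → q = 0) := by
  unfold Hd at hx
  induction hx using AddSubmonoid.closure_induction with
  | mem x h =>
    obtain ⟨r, hr, rfl⟩ := h
    refine ⟨1, r + 1, ?_, by omega, by omega⟩
    have h1 : m + 2 - 1 = m + 1 := by omega
    have h2 : m + 2 - 2 = m := by omega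
    rw [h1, h2]; ring
  | zero => exact ⟨0, 0, by simp, le_refl _, fun _ => rfl⟩
  | add x y _ _ hx hy =>
    obtain ⟨a, q, rfl, h1, h2⟩ := hx
    obtain ⟨a', q', rfl, h1', h2'⟩ := hy
    exact ⟨a + a', q + q', by ring, by omega, by omega⟩

theorem Sb_shape (m x : ℕ) (hm : 2 ≤ m) (hx : x ∈ Sb (m + 2)) :
    ∃ a b q : ℕ, x = 2 * a + 5 * b + 2 * (m * q) ∧ a + 4 * b ≤ q ∧
      (a = 0 → q ≤ b * (m + 2)) := by
  unfold Sb at hx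
  induction hx using AddSubmonoid.closure_induction with
  | mem x h =>
    rcases h with ⟨h, hh, rfl⟩ | ⟨r, hr, rfl⟩
    · obtain ⟨a, q, rfl, h1, h2⟩ := Hd_shape m h hh
      exact ⟨a, 0, q, by ring, by omega, by omega⟩
    · refine ⟨0, 1, r + 4, ?_, by omega, by omega⟩
      have h1 : 8 * (m + 2) - 11 = 8 * m + 5 := by omega
      have h2 : m + 2 - 2 = m := by omega
      rw [h1, h2]; ring
  | zero => exact ⟨0, 0, 0, by simp, le_refl _, by simp⟩
  | add x y _ _ hx hy =>
    obtain ⟨a, b, q, rfl, h1, h2⟩ := hx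
    obtain ⟨a', b', q', rfl, h1', h2'⟩ := hy
    refine ⟨a + a', b + b', q + q', by ring, by omega, fun h => ?_⟩
    have e1 := h2 (by omega)
    have e2 := h2' (by omega)
    rw [add_mul]; omega

/-- `2d² - 3 ∉ S_b`. -/
theorem stmt_12 (d : ℕ) (hd : 4 ≤ d) : 2 * d ^ 2 - 3 ∉ Sb d := by
  intro hx
  obtain ⟨m, rfl⟩ : ∃ m, d = m + 2 := ⟨d - 2, by omega⟩
  obtain ⟨a, b, q, h, h1, h2⟩ := Sb_shape m _ (by omega) hx
  have e : 2 * (m + 2) ^ 2 - 3 = 2 * (m * (m + 4)) + 5 := by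
    have : 2 * (m + 2) ^ 2 = 2 * (m * (m + 4)) + 8 := by ring
    omega
  rw [e] at h
  obtain ⟨c, rfl⟩ : ∃ c, b = 2 * c + 1 := ⟨b / 2, by omega⟩
  have h3 : m * (m + 4) = (a + 5 * c) + m * q := by omega
  have hdvd : m ∣ a + 5 * c :=
    (Nat.dvd_add_left (Dvd.intro q rfl)).1 (h3 ▸ Dvd.intro (m + 4) rfl)
  rcases Nat.eq_zero_or_pos (a + 5 * c) with h0 | h0
  · have ha : a = 0 := by omega
    have hc : c = 0 := by omega
    subst ha hc
    have h4 := h2 rfl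
    have h5 : m + 4 = q := Nat.eq_of_mul_eq_mul_left (by omega : 0 < m) (by omega)
    omega
  · have h4 := Nat.le_of_dvd h0 hdvd
    have h5 : m * (m + 4) ≤ m * q := Nat.mul_le_mul_left m (by omega)
    omega
end

section
/- Let d ≥ 4 be an integer. Then 2d² - 2d + 1 does not belong to the additive submonoid S_b. -/
lemma Hd_form (m x : ℕ) (hx : x ∈ Hd (m + 2)) :
    ∃ k R : ℕ, R ≤ k * m ∧ x = k * (m + 1) + R * m := by
  unfold Hd at hx
  induction hx using AddSubmonoid.closure_induction with
  | mem x h =>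
    obtain ⟨r, hr, rfl⟩ := h
    refine ⟨1, r, by simpa using hr, ?_⟩
    simp
  | zero => exact ⟨0, 0, by simp, by simp⟩
  | add x y _ _ h1 h2 =>
    obtain ⟨k, R, hR, rfl⟩ := h1
    obtain ⟨k', R', hR', rfl⟩ := h2
    exact ⟨k + k', R + R', by nlinarith, by ring⟩

lemma Sb_form (m x : ℕ) (hm : 2 ≤ m) (hx : x ∈ Sb (m + 2)) :
    ∃ k R j T : ℕ, R ≤ k * m ∧ T + 2 * j ≤ j * m ∧
      x = 2 * (k * (m + 1) + R * m) + j * (8 * m + 5) + 2 * T * m := by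
  unfold Sb at hx
  induction hx using AddSubmonoid.closure_induction with
  | mem x h =>
    rcases h with ⟨h, hh, rfl⟩ | ⟨r, hr, rfl⟩
    · obtain ⟨k, R, hR, rfl⟩ := Hd_form m h hh
      exact ⟨k, R, 0, 0, hR, by simp, by simp⟩
    · refine ⟨0, 0, 1, r, by simp, by omega, ?_⟩
      have h1 : 8 * (m + 2) - 11 = 8 * m + 5 := by omega
      rw [h1]
      simp
  | zero => exact ⟨0, 0, 0, 0, by simp, by simp, by simp⟩
  | add x y _ _ h1 h2 =>
    obtain ⟨k, R, j, T, hR, hT, rfl⟩ := h1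
    obtain ⟨k', R', j', T', hR', hT', rfl⟩ := h2
    exact ⟨k + k', R + R', j + j', T + T', by nlinarith, by nlinarith, by ring⟩

/-- `2d² - 2d + 1 ∉ S_b`. -/
theorem stmt_13 (d : ℕ) (hd : 4 ≤ d) : 2 * d ^ 2 - 2 * d + 1 ∉ Sb d := by
  obtain ⟨m, rfl⟩ : ∃ m, d = m + 2 := ⟨d - 2, by omega⟩
  intro hx
  have hm : 2 ≤ m := by omega
  obtain ⟨k, R, j, T, hR, hT, h⟩ := Sb_form m _ hm hx
  have h0 : 2 * (m + 2) ^ 2 - 2 * (m + 2) = 2 * (m ^ 2 + 3 * m + 2) := by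
    apply Nat.sub_eq_of_eq_add
    ring
  rw [h0] at h
  rcases Nat.even_or_odd' j with ⟨i, rfl | rfl⟩
  · have : 2 * (m ^ 2 + 3 * m + 2) + 1
      = 2 * (k * (m + 1) + R * m + i * (8 * m + 5) + T * m) := by
      rw [h]; ring
    omega
  · have h2 : m * (m + 3) = (k + 5 * i) + m * (k + R + T + 4 + 8 * i) := by
      nlinarith
    have hdvd : m ∣ k + 5 * i :=
      (Nat.dvd_add_left (Dvd.intro _ rfl)).1 (h2 ▸ Dvd.intro _ rfl)
    obtain ⟨c, hc⟩ := hdvd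
    rw [hc, ← Nat.mul_add] at h2
    have h3 := Nat.eq_of_mul_eq_mul_left (by omega) h2
    rcases Nat.eq_zero_or_pos c with rfl | hpos
    · obtain rfl : k = 0 := by omega
      obtain rfl : i = 0 := by omega
      omega
    · have : m ≤ m * c := Nat.le_mul_of_pos_right m hpos
      omega
end

section
/- Let d ≥ 4 be an integer. Then {m ∈ ℕ : 2m ∈ S_a} = H_d; that is, a natural number m satisfies 2m ∈ S_a if and only if m ∈ H_d. -/
theorem two_odd_mem (d : ℕ) (hd : 4 ≤ d) (r s : ℕ) (hr : r ≤ d - 3) (hs : s ≤ d - 3) :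
    ∃ k ∈ Hd d, (8 * d - 9 + 2 * r * (d - 2)) + (8 * d - 9 + 2 * s * (d - 2)) = 2 * k := by
  obtain ⟨e, rfl⟩ : ∃ e, d = e + 4 := ⟨d - 4, by omega⟩
  have gen : ∀ r, r ≤ e + 2 → (e + 3) + r * (e + 2) ∈ Hd (e + 4) := fun r h =>
    AddSubmonoid.subset_closure ⟨r, by omega, by simp⟩
  have h0 := gen 0 (by omega)
  have h1 := gen (r + 1) (by omega)
  have h2 := gen s (by omega)
  refine ⟨_, add_mem (AddSubmonoid.nsmul_mem _ h0 5) (add_mem h1 h2), ?_⟩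
  have e1 : 8 * (e + 4) - 9 = 8 * e + 23 := by omega
  have e2 : e + 4 - 2 = e + 2 := by omega
  rw [e1, e2, smul_eq_mul]
  ring

theorem Sa_form (d : ℕ) (hd : 4 ≤ d) (x : ℕ) (hx : x ∈ Sa d) :
    (∃ h ∈ Hd d, x = 2 * h) ∨
    (∃ h ∈ Hd d, ∃ r ≤ d - 3, x = 2 * h + (8 * d - 9 + 2 * r * (d - 2))) := by
  unfold Sa at hx
  induction hx using AddSubmonoid.closure_induction with
  | mem x hx =>
    rcases hx with hx | ⟨r, hr, rfl⟩
    · exact Or.inl hx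
    · exact Or.inr ⟨0, zero_mem _, r, hr, by simp⟩
  | zero => exact Or.inl ⟨0, zero_mem _, rfl⟩
  | add x y _ _ hx hy =>
    rcases hx with ⟨h, hh, rfl⟩ | ⟨h, hh, r, hr, rfl⟩ <;>
    rcases hy with ⟨k, hk, rfl⟩ | ⟨k, hk, s, hs, rfl⟩
    · exact Or.inl ⟨h + k, add_mem hh hk, by ring⟩
    · exact Or.inr ⟨h + k, add_mem hh hk, s, hs, by ring⟩
    · exact Or.inr ⟨h + k, add_mem hh hk, r, hr, by ring⟩
    · obtain ⟨l, hl, e⟩ := two_odd_mem d hd r s hr hs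
      exact Or.inl ⟨h + k + l, add_mem (add_mem hh hk) hl, by omega⟩

/-- `d₂(S_a) = H_d`: a natural number `m` satisfies `2m ∈ S_a` iff `m ∈ H_d`. -/
theorem stmt_15 (d : ℕ) (hd : 4 ≤ d) :
    {m : ℕ | 2 * m ∈ Sa d} = {m : ℕ | m ∈ Hd d} := by
  ext m
  simp only [Set.mem_setOf_eq]
  constructor
  · intro hm
    rcases Sa_form d hd _ hm with ⟨h, hh, e⟩ | ⟨h, hh, r, hr, e⟩
    · have : m = h := by omega
      exact this ▸ hh
    · rw [mul_assoc] at e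
      omega
  · intro hm
    exact AddSubmonoid.subset_closure (Or.inl ⟨m, hm, rfl⟩)
end

section
/- Let d ≥ 4 be an integer. Then {m ∈ ℕ : 2m ∈ S_b} = H_d; that is, a natural number m satisfies 2m ∈ S_b if and only if m ∈ H_d. -/
/-- Half the sum of two odd generators of `Sb d` lies in `Hd d` (with `d = e + 4`). -/
theorem half_sum_mem (e r : ℕ) (hr : r ≤ 2 * e) : (8 * e + 21) + r * (e + 2) ∈ Hd (e + 4) := by
  have gen : ∀ a, a ≤ e + 2 → (e + 3) + a * (e + 2) ∈ Hd (e + 4) := fun a ha =>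
    AddSubmonoid.subset_closure ⟨a, by omega, rfl⟩
  obtain ⟨a, b, ha, hb, hab⟩ : ∃ a b, a ≤ e + 2 ∧ b ≤ e + 2 ∧ a + b = r + 3 := by
    by_cases h : r + 3 ≤ e + 2
    · exact ⟨r + 3, 0, h, by omega, by omega⟩
    · exact ⟨e + 2, r + 3 - (e + 2), le_rfl, by omega, by omega⟩
  have h0 := gen 0 (by omega)
  have h := add_mem (add_mem (add_mem (add_mem (gen a ha) (gen b hb)) h0) h0) h0
  have heq : (8 * e + 21) + r * (e + 2) =
      (e + 3) + a * (e + 2) + ((e + 3) + b * (e + 2)) + ((e + 3) + 0 * (e + 2))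
        + ((e + 3) + 0 * (e + 2)) + ((e + 3) + 0 * (e + 2)) := by
    have : (a + b) * (e + 2) = (r + 3) * (e + 2) := by rw [hab]
    linarith
  rw [heq]
  exact h

theorem Sb_form_s16 (e x : ℕ) (hx : x ∈ Sb (e + 4)) :
    (∃ h ∈ Hd (e + 4), x = 2 * h) ∨
    (∃ h ∈ Hd (e + 4), ∃ r, r ≤ e ∧ x = 2 * h + ((8 * e + 21) + 2 * (r * (e + 2)))) := by
  unfold Sb at hx
  induction hx using AddSubmonoid.closure_induction with
  | mem x hx =>
    rcases hx with hx | ⟨r, hr, rfl⟩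
    · exact Or.inl hx
    · refine Or.inr ⟨0, zero_mem _, r, by omega, ?_⟩
      have h1 : 8 * (e + 4) - 11 = 8 * e + 21 := by omega
      have h2 : e + 4 - 2 = e + 2 := by omega
      rw [h1, h2]
      ring
  | zero => exact Or.inl ⟨0, zero_mem _, rfl⟩
  | add x y _ _ ihx ihy =>
    rcases ihx with ⟨h, hh, rfl⟩ | ⟨h, hh, r, hr, rfl⟩ <;>
    rcases ihy with ⟨k, hk, rfl⟩ | ⟨k, hk, s, hs, rfl⟩
    · exact Or.inl ⟨h + k, add_mem hh hk, by ring⟩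
    · exact Or.inr ⟨h + k, add_mem hh hk, s, hs, by ring⟩
    · exact Or.inr ⟨h + k, add_mem hh hk, r, hr, by ring⟩
    · exact Or.inl ⟨h + k + ((8 * e + 21) + (r + s) * (e + 2)),
        add_mem (add_mem hh hk) (half_sum_mem e (r + s) (by omega)), by ring⟩

/-- `d₂(S_b) = H_d`: a natural number `m` satisfies `2m ∈ S_b` iff `m ∈ H_d`. -/
theorem stmt_16 (d : ℕ) (hd : 4 ≤ d) :
    {m : ℕ | 2 * m ∈ Sb d} = {m : ℕ | m ∈ Hd d} := by
  obtain ⟨e, rfl⟩ : ∃ e, d = e + 4 := ⟨d - 4, by omega⟩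
  ext m
  simp only [Set.mem_setOf_eq]
  constructor
  · intro hm
    rcases Sb_form_s16 e _ hm with ⟨h, hh, heq⟩ | ⟨h, hh, r, hr, heq⟩
    · have : m = h := by omega
      rw [this]
      exact hh
    · omega
  · intro hm
    exact AddSubmonoid.subset_closure (Or.inl ⟨m, hm, rfl⟩)
end

section
/- Let d ≥ 4 be an integer. Then {m ∈ ℕ : 2m ∈ S_c} = H_d; that is, a natural number m satisfies 2m ∈ S_c if and only if m ∈ H_d. -/
theorem hd_mem (n k R : ℕ) (h : R ≤ k * n) : k * (n + 1) + R * n ∈ Hd (n + 2) := by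
  induction k generalizing R with
  | zero =>
    have : R = 0 := by omega
    subst this
    simp
  | succ k ih =>
    have h' : R ≤ k * n + n := by rw [Nat.succ_mul] at h; exact h
    obtain ⟨a, b, ha, hb, rfl⟩ : ∃ a b, a ≤ k * n ∧ b ≤ n ∧ R = a + b :=
      ⟨R - min R n, min R n, by omega, by omega, by omega⟩
    have h1 := ih a ha
    have h2 : (n + 1) + b * n ∈ Hd (n + 2) := by
      apply AddSubmonoid.subset_closure
      exact ⟨b, by omega, by simp⟩
    have := add_mem h1 h2
    convert this using 1
    ring

theorem sc_mem (n : ℕ) (hn : 2 ≤ n) (x : ℕ) (hx : x ∈ Sc (n + 2)) :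
    (∃ h ∈ Hd (n + 2), x = 2 * h) ∨
    (∃ r ≤ n, ∃ h ∈ Hd (n + 2), x = 8 * n + 7 + 2 * (r * n) + 2 * h) := by
  unfold Sc at hx
  induction hx using AddSubmonoid.closure_induction with
  | mem x hx =>
    rcases hx with (hx | ⟨r, hr, rfl⟩) | hx
    · exact Or.inl hx
    · right
      refine ⟨r, by omega, 0, zero_mem _, ?_⟩
      have : n + 2 - 2 = n := by omega
      rw [this, mul_assoc]
      omega
    · right
      refine ⟨n, le_rfl, 0, zero_mem _, ?_⟩
      rw [Set.mem_singleton_iff] at hx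
      have : 2 * (n + 2) ^ 2 = 2 * (n * n) + 8 * n + 8 := by ring
      omega
  | zero => exact Or.inl ⟨0, zero_mem _, rfl⟩
  | add x y _ _ hx hy =>
    rcases hx with ⟨h, hh, rfl⟩ | ⟨r, hr, h, hh, rfl⟩ <;>
    rcases hy with ⟨g, hg, rfl⟩ | ⟨s, hs, g, hg, rfl⟩
    · exact Or.inl ⟨h + g, add_mem hh hg, by ring⟩
    · exact Or.inr ⟨s, hs, h + g, add_mem hh hg, by ring⟩
    · exact Or.inr ⟨r, hr, h + g, add_mem hh hg, by ring⟩
    · refine Or.inl ⟨_, add_mem (hd_mem n 7 (r + s + 1) (by omega)) (add_mem hh hg), by ring⟩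

/-- `d₂(S_c) = H_d`: a natural number `m` satisfies `2m ∈ S_c` iff `m ∈ H_d`. -/
theorem stmt_17 (d : ℕ) (hd : 4 ≤ d) :
    {m : ℕ | 2 * m ∈ Sc d} = {m : ℕ | m ∈ Hd d} := by
  obtain ⟨n, rfl⟩ : ∃ n, d = n + 2 := ⟨d - 2, by omega⟩
  ext m
  simp only [Set.mem_setOf_eq]
  constructor
  · intro hm
    rcases sc_mem n (by omega) _ hm with ⟨h, hh, e⟩ | ⟨r, _, h, _, e⟩
    · have : m = h := by omega
      exact this ▸ hh
    · omega
  · intro hm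
    exact AddSubmonoid.subset_closure (Or.inl (Or.inl ⟨m, hm, rfl⟩))
end
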